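/- arXiv:2605.23191 — 8 statements merged into one kernel-verified Lean document; each statement's English description precedes it below -/
import Mathlib

section
/- Let T, D be positive integers and let X, Y ∈ ℝ^{T×D} be nonzero real matrices such that the Frobenius inner product ⟨X, Y⟩_F = 0 and ‖Y‖_F = ‖X‖_F. Set k = erank(X) and μ = erank(Y). Then X + Y ≠ 0 and erank(X + Y) ≥ 2kμ/(√k + √μ)². -/
open scoped BigOperators

/-- Squared Frobenius norm of a real matrix. -/
noncomputable def frobSq {T D : ℕ} (M : Matrix (Fin T) (Fin D) ℝ) : ℝ :=
  ∑ i, ∑ j, (M i j) ^ 2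

/-- Frobenius norm of a real matrix. -/
noncomputable def frobNorm {T D : ℕ} (M : Matrix (Fin T) (Fin D) ℝ) : ℝ :=
  Real.sqrt (frobSq M)

/-- Frobenius inner product of two real matrices of the same shape. -/
noncomputable def frobInner {T D : ℕ} (X Y : Matrix (Fin T) (Fin D) ℝ) : ℝ :=
  ∑ i, ∑ j, X i j * Y i j

/-- Operator (spectral) norm of a real matrix, induced by Euclidean norms. -/
noncomputable def opNorm {T D : ℕ} (M : Matrix (Fin T) (Fin D) ℝ) : ℝ :=
  ‖(Matrix.toEuclideanLin M).toContinuousLinearMap‖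

/-- Effective rank (stable rank) of a real matrix. -/
noncomputable def erank {T D : ℕ} (M : Matrix (Fin T) (Fin D) ℝ) : ℝ :=
  frobSq M / (opNorm M) ^ 2

lemma frobSq_pos_aux {T D : ℕ} (M : Matrix (Fin T) (Fin D) ℝ) (h : M ≠ 0) : 0 < frobSq M := by
  have h0 : 0 ≤ frobSq M := Finset.sum_nonneg fun i _ => Finset.sum_nonneg fun j _ => sq_nonneg _
  refine lt_of_le_of_ne h0 fun h1 => h ?_
  ext i j
  have h2 := (Finset.sum_eq_zero_iff_of_nonneg
    (fun i _ => Finset.sum_nonneg fun j _ => sq_nonneg (M i j))).1 h1.symm i (Finset.mem_univ i)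
  have h3 := (Finset.sum_eq_zero_iff_of_nonneg
    (fun j _ => sq_nonneg (M i j))).1 h2 j (Finset.mem_univ j)
  simpa using h3

lemma opNorm_pos_aux {T D : ℕ} (M : Matrix (Fin T) (Fin D) ℝ) (h : M ≠ 0) : 0 < opNorm M := by
  unfold opNorm
  rw [norm_pos_iff]
  intro h0
  apply h
  simpa using h0

lemma opNorm_add_aux {T D : ℕ} (X Y : Matrix (Fin T) (Fin D) ℝ) :
    opNorm (X + Y) ≤ opNorm X + opNorm Y := by
  unfold opNorm
  rw [map_add, map_add]
  exact norm_add_le _ _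

lemma frobSq_add_aux {T D : ℕ} (X Y : Matrix (Fin T) (Fin D) ℝ) :
    frobSq (X + Y) = frobSq X + 2 * frobInner X Y + frobSq Y := by
  unfold frobSq frobInner
  simp only [Finset.mul_sum, ← Finset.sum_add_distrib, Matrix.add_apply]
  refine Finset.sum_congr rfl fun i _ => Finset.sum_congr rfl fun j _ => ?_
  ring

/-- If `X, Y` are nonzero real `T × D` matrices with zero Frobenius
inner product and equal Frobenius norms, then `X + Y ≠ 0` and, with `k = erank X`
and `μ = erank Y`, we have `erank (X + Y) ≥ 2kμ / (√k + √μ)²`. -/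
theorem erank_sum_lower_bound {T D : ℕ} (hT : 0 < T) (hD : 0 < D)
    (X Y : Matrix (Fin T) (Fin D) ℝ) (hX : X ≠ 0) (hY : Y ≠ 0)
    (horth : frobInner X Y = 0) (hnorm : frobNorm Y = frobNorm X)
    (k μ : ℝ) (hk : k = erank X) (hμ : μ = erank Y) :
    X + Y ≠ 0 ∧
      2 * k * μ / (Real.sqrt k + Real.sqrt μ) ^ 2 ≤ erank (X + Y) := by
  have hFX := frobSq_pos_aux X hX
  have hFY := frobSq_pos_aux Y hY
  have hF : frobSq Y = frobSq X := (Real.sqrt_inj hFY.le hFX.le).1 hnorm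
  have hS : frobSq (X + Y) = 2 * frobSq X := by
    rw [frobSq_add_aux, horth, hF]; ring
  have hne : X + Y ≠ 0 := by
    intro h
    rw [h] at hS
    simp [frobSq] at hS
    simp [frobSq] at hFX
    linarith
  refine ⟨hne, ?_⟩
  have ha := opNorm_pos_aux X hX
  have hb := opNorm_pos_aux Y hY
  have hc := opNorm_pos_aux _ hne
  have hadd := opNorm_add_aux X Y
  subst hk hμ
  unfold erank
  rw [hS, hF, Real.sqrt_div hFX.le, Real.sqrt_div hFX.le, Real.sqrt_sq ha.le, Real.sqrt_sq hb.le]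
  generalize opNorm X = a at *
  generalize opNorm Y = b at *
  generalize opNorm (X + Y) = c at *
  have hs := Real.sqrt_pos.2 hFX
  have hs2 := Real.sq_sqrt hFX.le
  generalize Real.sqrt (frobSq X) = f at *
  rw [← hs2]
  have e : 2 * (f ^ 2 / a ^ 2) * (f ^ 2 / b ^ 2) / (f / a + f / b) ^ 2
      = 2 * f ^ 2 / (a + b) ^ 2 := by
    have : f / a + f / b = f * (a + b) / (a * b) := by field_simp; ring
    rw [this]
    field_simp
  rw [e]
  gcongr
end

section
/- Let T, d be positive integers and let X be a real T × (T·d) matrix with columns indexed by pairs (j, s) ∈ (Fin T) × (Fin d). Let 𝒯(X) be the block transpose of X. Then rank(𝒯(X)) ≤ min(T, rank(X) · d). -/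
open scoped BigOperators

/-- Block transpose of a real `T × (T·d)` matrix whose columns are indexed by
pairs `(j, s) ∈ Fin T × Fin d`: `(𝒯X)[i, (j, s)] = X[j, (i, s)]`. -/
def blockT {T d : ℕ} (X : Matrix (Fin T) (Fin T × Fin d) ℝ) :
    Matrix (Fin T) (Fin T × Fin d) ℝ :=
  Matrix.of fun i js => X js.1 (i, js.2)

/-- The rank of the block transpose of `X` is at most
`min (T, rank X · d)`. -/
theorem rank_blockT_le {T d : ℕ} (hT : 0 < T) (hd : 0 < d)
    (X : Matrix (Fin T) (Fin T × Fin d) ℝ) :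
    (blockT X).rank ≤ min T (X.rank * d) := by
  refine le_min ((blockT X).rank_le_card_height.trans (Fintype.card_fin T).le) ?_
  have hr := X.rank_eq_finrank_span_row
  set W := Submodule.span ℝ (Set.range X.row) with hW
  let b := Module.finBasis ℝ W
  have hmem : ∀ j, X.row j ∈ W := fun j => Submodule.subset_span ⟨j, rfl⟩
  have hX : ∀ j c, X j c = ∑ k, b.repr ⟨X.row j, hmem j⟩ k * (b k : Fin T × Fin d → ℝ) c := by
    intro j c
    have h := congrArg (fun w : W => (w : Fin T × Fin d → ℝ) c) (b.sum_repr ⟨X.row j, hmem j⟩)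
    simp only [Submodule.coe_sum, Submodule.coe_smul, Finset.sum_apply, Pi.smul_apply,
      smul_eq_mul] at h
    exact h.symm
  let A : Matrix (Fin T) (Fin (Module.finrank ℝ W) × Fin d) ℝ :=
    Matrix.of fun i ks => (b ks.1 : Fin T × Fin d → ℝ) (i, ks.2)
  let B : Matrix (Fin (Module.finrank ℝ W) × Fin d) (Fin T × Fin d) ℝ :=
    Matrix.of fun ks js => if ks.2 = js.2 then b.repr ⟨X.row js.1, hmem js.1⟩ ks.1 else 0
  have hAB : blockT X = A * B := by
    ext i ⟨j, s⟩
    simp only [blockT, A, B, Matrix.mul_apply, Matrix.of_apply, Fintype.sum_prod_type, mul_ite,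
      mul_zero, Finset.sum_ite_eq', Finset.sum_ite_eq, Finset.mem_univ, if_true]
    rw [hX]
    exact Finset.sum_congr rfl fun k _ => mul_comm _ _
  rw [hAB, hr]
  refine (Matrix.rank_mul_le_left A B).trans ((Matrix.rank_le_card_width A).trans ?_)
  simp
end

section
/- Let T, d be positive integers, u ∈ ℝ^T, and v ∈ ℝ^{T·d} with coordinates indexed by pairs (j, s) ∈ (Fin T) × (Fin d). Let X = u vᵀ be the rank-at-most-one T × (T·d) matrix X[i, (j, s)] = u_i · v_{(j,s)}, and let 𝒯(X) be its block transpose. Then rank(𝒯(X)) ≤ min(T, d). -/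
open scoped BigOperators

/-- For a rank-at-most-one matrix `X = u vᵀ` (entrywise
`X[i, (j, s)] = u i * v (j, s)`), the block transpose has rank at most `min (T, d)`. -/
theorem rank_blockT_rank_one_le {T d : ℕ} (hT : 0 < T) (hd : 0 < d)
    (u : Fin T → ℝ) (v : Fin T × Fin d → ℝ) :
    (blockT (Matrix.of fun i js => u i * v js)).rank ≤ min T d := by
  refine le_min ?_ ?_
  · exact (Matrix.rank_le_card_height _).trans (Fintype.card_fin T).le
  · have h : blockT (Matrix.of fun i js => u i * v js) =
        (Matrix.of fun (i : Fin T) (s : Fin d) => v (i, s)) *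
        (Matrix.of fun (s : Fin d) (js : Fin T × Fin d) => if s = js.2 then u js.1 else 0) := by
      ext i js
      simp [blockT, Matrix.mul_apply, mul_comm]
    rw [h]
    exact (Matrix.rank_mul_le_left _ _).trans
      ((Matrix.rank_le_card_width _).trans (Fintype.card_fin d).le)
end

section
/- Let T, D, m be positive integers, let c ∈ ℝ^T, v ∈ ℝ^D, and let X = c vᵀ ∈ ℝ^{T×D} be a matrix of algebraic rank at most 1. Let φ : ℝ → ℝ be positively homogeneous of degree 1, i.e., φ(t z) = t · φ(z) for all t ≥ 0 and z ∈ ℝ, applied entrywise to matrices. Then for every A ∈ ℝ^{D×m} and B ∈ ℝ^{m×D}, the matrix F(X) = φ(X A) B satisfies rank(F(X)) ≤ 2. -/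
open scoped BigOperators

/-- `φ : ℝ → ℝ` is positively homogeneous of degree 1:
`φ (t z) = t φ z` for all `t ≥ 0` and all `z`. -/
def PosHomog (φ : ℝ → ℝ) : Prop :=
  ∀ t : ℝ, 0 ≤ t → ∀ z : ℝ, φ (t * z) = t * φ z

/-- The per-row feedforward map `F(X) = φ(X A) B`, with `φ` applied entrywise. -/
def ffn {T D m : ℕ} (φ : ℝ → ℝ) (X : Matrix (Fin T) (Fin D) ℝ)
    (A : Matrix (Fin D) (Fin m) ℝ) (B : Matrix (Fin m) (Fin D) ℝ) :
    Matrix (Fin T) (Fin D) ℝ :=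
  ((X * A).map φ) * B

/-- **Homogeneity barrier.** If `X = c vᵀ` has rank at most one and
`φ` is positively homogeneous of degree 1, then `rank (φ(X A) B) ≤ 2`. -/
theorem rank_ffn_rank_one_le_two {T D m : ℕ} (hT : 0 < T) (hD : 0 < D) (hm : 0 < m)
    (c : Fin T → ℝ) (v : Fin D → ℝ) (φ : ℝ → ℝ) (hφ : PosHomog φ)
    (A : Matrix (Fin D) (Fin m) ℝ) (B : Matrix (Fin m) (Fin D) ℝ) :
    (ffn φ (Matrix.vecMulVec c v) A B).rank ≤ 2 := by
  have key : (Matrix.vecMulVec c v * A).map φ =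
      (Matrix.of fun (i : Fin T) (k : Fin 2) => ![max (c i) 0, max (-c i) 0] k) *
      (Matrix.of fun (k : Fin 2) (j : Fin m) =>
        ![φ (∑ d, v d * A d j), φ (-∑ d, v d * A d j)] k) := by
    ext i j
    have h : (Matrix.vecMulVec c v * A) i j = c i * ∑ d, v d * A d j := by
      simp [Matrix.mul_apply, Matrix.vecMulVec_apply, Finset.mul_sum, mul_assoc]
    rw [Matrix.map_apply, h]
    simp only [Matrix.mul_apply, Fin.sum_univ_two, Matrix.of_apply, Matrix.cons_val_zero,
      Matrix.cons_val_one]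
    generalize (∑ d, v d * A d j) = u
    rcases le_total 0 (c i) with hc | hc
    · rw [max_eq_left hc, max_eq_right (by linarith), hφ _ hc]
      ring
    · rw [max_eq_right hc, max_eq_left (by linarith), ← hφ (-c i) (by linarith)]
      simp
  unfold ffn
  rw [key]
  refine (Matrix.rank_mul_le_left _ _).trans ((Matrix.rank_mul_le_left _ _).trans ?_)
  exact (Matrix.rank_le_card_width _).trans (by simp)
end

section
/- Let T, D, m be positive integers, let c ∈ ℝ^T with all entries c_i ≥ 0 (respectively, all entries c_i ≤ 0), let v ∈ ℝ^D, and let X = c vᵀ ∈ ℝ^{T×D}. Let φ : ℝ → ℝ be positively homogeneous of degree 1, applied entrywise. Then for every A ∈ ℝ^{D×m} and B ∈ ℝ^{m×D}, the matrix F(X) = φ(X A) B has rank(F(X)) ≤ 1. -/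
open scoped BigOperators

/-- If `X = c vᵀ` where all entries of `c` share the same sign
(all nonnegative, or all nonpositive) and `φ` is positively homogeneous of degree 1,
then `rank (φ(X A) B) ≤ 1`. -/
theorem rank_ffn_signed_le_one {T D m : ℕ} (hT : 0 < T) (hD : 0 < D) (hm : 0 < m)
    (c : Fin T → ℝ) (hc : (∀ i, 0 ≤ c i) ∨ (∀ i, c i ≤ 0))
    (v : Fin D → ℝ) (φ : ℝ → ℝ) (hφ : PosHomog φ)
    (A : Matrix (Fin D) (Fin m) ℝ) (B : Matrix (Fin m) (Fin D) ℝ) :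
    (ffn φ (Matrix.vecMulVec c v) A B).rank ≤ 1 := by
  unfold ffn
  refine (Matrix.rank_mul_le_left _ _).trans ?_
  rw [Matrix.vecMulVec_mul]
  rcases hc with hc | hc
  · have h : (Matrix.vecMulVec c (Matrix.vecMul v A)).map φ
        = Matrix.vecMulVec c (fun j => φ (Matrix.vecMul v A j)) := by
      ext i j
      simp only [Matrix.map_apply, Matrix.vecMulVec_apply]
      exact hφ _ (hc i) _
    rw [h]
    exact Matrix.rank_vecMulVec_le _ _
  · have h : (Matrix.vecMulVec c (Matrix.vecMul v A)).map φ
        = Matrix.vecMulVec (fun i => - c i) (fun j => φ (-(Matrix.vecMul v A j))) := by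
      ext i j
      simp only [Matrix.map_apply, Matrix.vecMulVec_apply]
      rw [← hφ _ (neg_nonneg.mpr (hc i)), neg_mul_neg]
    rw [h]
    exact Matrix.rank_vecMulVec_le _ _
end

section
/- Let T, D, m be positive integers, c ∈ ℝ^T, v ∈ ℝ^D, X = c vᵀ ∈ ℝ^{T×D}, and let φ : ℝ → ℝ be positively homogeneous of degree 1, applied entrywise. Let A ∈ ℝ^{D×m}, B ∈ ℝ^{m×D}, and set u = vᵀ A ∈ ℝ^{1×m}, w₊ = φ(u) B ∈ ℝ^{1×D}, w₋ = φ(−u) B ∈ ℝ^{1×D}, c⁺_i = max(c_i, 0), c⁻_i = max(−c_i, 0). Then F(X) = φ(X A) B equals the sum of two outer products: F(X) = c⁺ w₊ + c⁻ w₋, i.e., for every row i, the i-th row of F(X) equals c⁺_i w₊ + c⁻_i w₋. -/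
open scoped BigOperators

/-- For `X = c vᵀ`, with `u = vᵀ A`, `w₊ = φ(u) B`, `w₋ = φ(−u) B`,
`c⁺ᵢ = max (cᵢ) 0` and `c⁻ᵢ = max (−cᵢ) 0`, the feedforward output decomposes as
the sum of two outer products: `F(X) = c⁺ w₊ᵀ + c⁻ w₋ᵀ`, i.e. row `i` of `F(X)`
equals `c⁺ᵢ w₊ + c⁻ᵢ w₋`. -/
theorem ffn_rank_one_decomposition {T D m : ℕ} (hT : 0 < T) (hD : 0 < D) (hm : 0 < m)
    (c : Fin T → ℝ) (v : Fin D → ℝ) (φ : ℝ → ℝ) (hφ : PosHomog φ)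
    (A : Matrix (Fin D) (Fin m) ℝ) (B : Matrix (Fin m) (Fin D) ℝ)
    (u : Fin m → ℝ) (hu : u = Matrix.vecMul v A)
    (wp wm : Fin D → ℝ)
    (hwp : wp = Matrix.vecMul (fun j => φ (u j)) B)
    (hwm : wm = Matrix.vecMul (fun j => φ (-(u j))) B)
    (cp cm : Fin T → ℝ)
    (hcp : cp = fun i => max (c i) 0) (hcm : cm = fun i => max (-(c i)) 0) :
    ffn φ (Matrix.vecMulVec c v) A B
        = Matrix.vecMulVec cp wp + Matrix.vecMulVec cm wm ∧
      ∀ i j, ffn φ (Matrix.vecMulVec c v) A B i j = cp i * wp j + cm i * wm j := by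
  have key : ∀ i j, ffn φ (Matrix.vecMulVec c v) A B i j = cp i * wp j + cm i * wm j := by
    intro i j
    have hX : ∀ k, (Matrix.vecMulVec c v * A) i k = c i * u k := by
      intro k
      rw [hu]
      simp only [Matrix.mul_apply, Matrix.vecMulVec_apply, Matrix.vecMul, dotProduct,
        Finset.mul_sum, mul_assoc]
    have hp : ∀ z, φ (c i * z) = max (c i) 0 * φ z + max (-(c i)) 0 * φ (-z) := by
      intro z
      rcases le_total 0 (c i) with h | h
      · rw [max_eq_left h, max_eq_right (by linarith), hφ _ h]
        ring
      · rw [max_eq_right h, max_eq_left (by linarith), ← hφ _ (by linarith : 0 ≤ -(c i)),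
          neg_mul_neg]
        ring
    rw [hwp, hwm, hcp, hcm]
    simp only [ffn, Matrix.mul_apply (M := (Matrix.vecMulVec c v * A).map φ), Matrix.map_apply,
      hX, hp, Matrix.vecMul, dotProduct, Finset.mul_sum, ← Finset.sum_add_distrib]
    refine Finset.sum_congr rfl fun k _ => ?_
    ring
  refine ⟨?_, key⟩
  ext i j
  rw [key i j]
  simp [Matrix.vecMulVec_apply]
end

section
/- Let T, D, m be positive integers, c ∈ ℝ^T, v ∈ ℝ^D, X = c vᵀ ∈ ℝ^{T×D}, and let φ : ℝ → ℝ be positively homogeneous of degree 1, applied entrywise. Let A ∈ ℝ^{D×m} and B ∈ ℝ^{m×D}, and suppose F(X) = φ(X A) B ≠ 0. Then erank(F(X)) ≤ 2. -/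
open scoped BigOperators

theorem aux_op {T D : ℕ} (M : Matrix (Fin T) (Fin D) ℝ) (p : Fin T → ℝ) (a : Fin D → ℝ)
    (h : ∀ i, p i = 0 ∨ ∀ j, M i j = p i * a j) :
    (∑ i, p i ^ 2) * (∑ j, a j ^ 2) ≤ opNorm M ^ 2 := by
  set S := ∑ j, a j ^ 2 with hS
  have hS0 : 0 ≤ S := Finset.sum_nonneg fun j _ => sq_nonneg _
  rcases hS0.eq_or_lt with h0 | hpos
  · rw [← h0, mul_zero]; positivity
  have h1 := (Matrix.toEuclideanLin M).toContinuousLinearMap.le_opNorm (WithLp.toLp 2 a)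
  have h2 := pow_le_pow_left₀ (norm_nonneg _) h1 2
  rw [mul_pow, EuclideanSpace.norm_sq_eq, EuclideanSpace.norm_sq_eq] at h2
  simp only [Real.norm_eq_abs, sq_abs] at h2
  change _ ≤ opNorm M ^ 2 * S at h2
  have h3 : (∑ i, p i ^ 2) * S ^ 2 ≤ opNorm M ^ 2 * S := by
    refine le_trans ?_ h2
    rw [Finset.sum_mul]
    refine Finset.sum_le_sum fun i _ => ?_
    rcases h i with hi | hi
    · rw [hi]
      simp only [ne_eq, OfNat.ofNat_ne_zero, not_false_eq_true, zero_pow, zero_mul]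
      positivity
    · have : ((Matrix.toEuclideanLin M).toContinuousLinearMap (WithLp.toLp 2 a)) i = p i * S := by
        change ∑ j, M i j * a j = _
        rw [hS, Finset.mul_sum]
        refine Finset.sum_congr rfl fun j _ => ?_
        rw [hi j]; ring
      rw [this, mul_pow]
  refine le_of_mul_le_mul_right ?_ hpos
  linarith

theorem aux_entry {T D m : ℕ} (c : Fin T → ℝ) (v : Fin D → ℝ) (φ : ℝ → ℝ) (hφ : PosHomog φ)
    (A : Matrix (Fin D) (Fin m) ℝ) (B : Matrix (Fin m) (Fin D) ℝ) (s t : ℝ) (i : Fin T)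
    (ht : 0 ≤ t) (hc : c i = t * s) (j : Fin D) :
    ffn φ (Matrix.vecMulVec c v) A B i j
      = t * ∑ k, φ (s * ∑ l, v l * A l k) * B k j := by
  simp only [ffn, Matrix.mul_apply, Matrix.map_apply, Matrix.vecMulVec_apply]
  rw [Finset.mul_sum]
  refine Finset.sum_congr rfl fun k _ => ?_
  rw [← mul_assoc, ← hφ t ht, ← mul_assoc, ← hc, Finset.mul_sum]
  simp only [mul_assoc]

/-- If `X = c vᵀ` has rank at most one, `φ` is positively
homogeneous of degree 1, and `F(X) = φ(X A) B ≠ 0`, then `erank (F(X)) ≤ 2`. -/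
theorem erank_ffn_rank_one_le_two {T D m : ℕ} (hT : 0 < T) (hD : 0 < D) (hm : 0 < m)
    (c : Fin T → ℝ) (v : Fin D → ℝ) (φ : ℝ → ℝ) (hφ : PosHomog φ)
    (A : Matrix (Fin D) (Fin m) ℝ) (B : Matrix (Fin m) (Fin D) ℝ)
    (hF : ffn φ (Matrix.vecMulVec c v) A B ≠ 0) :
    erank (ffn φ (Matrix.vecMulVec c v) A B) ≤ 2 := by
  set a : Fin D → ℝ := fun j => ∑ k, φ (1 * ∑ l, v l * A l k) * B k j with ha
  set b : Fin D → ℝ := fun j => ∑ k, φ ((-1) * ∑ l, v l * A l k) * B k j with hb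
  have hpos : ∀ i, 0 ≤ c i → ∀ j, ffn φ (Matrix.vecMulVec c v) A B i j = c i * a j :=
    fun i hi j => aux_entry c v φ hφ A B 1 (c i) i hi (by ring) j
  have hneg : ∀ i, c i ≤ 0 → ∀ j, ffn φ (Matrix.vecMulVec c v) A B i j = (-c i) * b j :=
    fun i hi j => aux_entry c v φ hφ A B (-1) (-c i) i (by linarith) (by ring) j
  generalize ffn φ (Matrix.vecMulVec c v) A B = M at *
  have h1 := aux_op M (fun i => max (c i) 0) a (fun i => by
    rcases le_total (c i) 0 with h | h
    · left; exact max_eq_right h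
    · right; intro j; rw [max_eq_left h]; exact hpos i h j)
  have h2 := aux_op M (fun i => max (-c i) 0) b (fun i => by
    rcases le_total (c i) 0 with h | h
    · right; intro j; rw [max_eq_left (by linarith)]; exact hneg i h j
    · left; exact max_eq_right (by linarith))
  have h3 : frobSq M = (∑ i, (max (c i) 0) ^ 2) * (∑ j, a j ^ 2)
      + (∑ i, (max (-c i) 0) ^ 2) * (∑ j, b j ^ 2) := by
    rw [frobSq, Finset.sum_mul, Finset.sum_mul, ← Finset.sum_add_distrib]
    refine Finset.sum_congr rfl fun i _ => ?_
    rcases le_total (c i) 0 with h | h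
    · rw [max_eq_right h, max_eq_left (by linarith : (0:ℝ) ≤ -c i), Finset.mul_sum (a := (-c i)^2)]
      simp only [hneg i h, mul_pow]
      ring
    · rw [max_eq_left h, max_eq_right (by linarith : -c i ≤ (0:ℝ)), Finset.mul_sum (a := (c i)^2)]
      simp only [hpos i h, mul_pow]
      ring
  rw [erank]
  refine div_le_of_le_mul₀ (sq_nonneg _) (by norm_num) ?_
  linarith
end

section
/- Let K and d be positive integers with d > 1, and let x ∈ ℝ^{K·d} be a vector with coordinates indexed by (Fin K) × (Fin d) and blocks b_1, …, b_K ∈ ℝ^d. Suppose the linear span V = span{b_1, …, b_K} is a proper subspace of ℝ^d. Then there exists a target vector z ∈ ℝ^{K·d} such that for every W ∈ ℝ^{K×K}, x + (W ⊗ I_d) x ≠ z; i.e., the reachable set {x + (W ⊗ I_d) x : W ∈ ℝ^{K×K}} is a proper subset of ℝ^{K·d}. -/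
open scoped BigOperators

/-- The Kronecker product `W ⊗ I_d` of `W ∈ ℝ^{K×K}` with the `d × d` identity,
as a `(K·d) × (K·d)` matrix indexed by pairs `(k, s), (j, t) ∈ Fin K × Fin d`:
entry `= W k j` if `s = t`, and `0` otherwise. -/
def kronId {K d : ℕ} (W : Matrix (Fin K) (Fin K) ℝ) :
    Matrix (Fin K × Fin d) (Fin K × Fin d) ℝ :=
  Matrix.of fun ks jt => if ks.2 = jt.2 then W ks.1 jt.1 else 0

/-- The `k`-th block of a vector `y ∈ ℝ^{K·d}` indexed by `Fin K × Fin d`. -/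
def block {K d : ℕ} (y : Fin K × Fin d → ℝ) (k : Fin K) : Fin d → ℝ :=
  fun s => y (k, s)

/-- If `d > 1` and the span of the blocks of `x` is a proper
subspace of `ℝ^d`, then some target `z` is unreachable by the residual
block-mixing update `x ↦ x + (W ⊗ I_d) x`, for every `W`; i.e. the reachable set
is a proper subset of `ℝ^{K·d}`. -/
theorem kron_mixing_strict_deficiency {K d : ℕ} (hK : 0 < K) (hd : 1 < d)
    (x : Fin K × Fin d → ℝ)
    (hV : Submodule.span ℝ (Set.range fun j : Fin K => block x j) ≠ ⊤) :
    (∃ z : Fin K × Fin d → ℝ,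
      ∀ W : Matrix (Fin K) (Fin K) ℝ, x + (kronId W).mulVec x ≠ z) ∧
    {y : Fin K × Fin d → ℝ | ∃ W : Matrix (Fin K) (Fin K) ℝ,
        y = x + (kronId W).mulVec x} ≠ Set.univ := by
  have key : ∃ z : Fin K × Fin d → ℝ,
      ∀ W : Matrix (Fin K) (Fin K) ℝ, x + (kronId W).mulVec x ≠ z := by
    obtain ⟨v, hv⟩ : ∃ v, v ∉ Submodule.span ℝ (Set.range fun j : Fin K => block x j) := by
      by_contra! h
      exact hV (Submodule.eq_top_iff'.2 h)
    refine ⟨fun p => v p.2, fun W h => hv ?_⟩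
    have hv' : v = block x ⟨0, hK⟩ + ∑ j, W ⟨0, hK⟩ j • block x j := by
      funext s
      have := congrFun h (⟨0, hK⟩, s)
      simp only [Pi.add_apply, Matrix.mulVec, dotProduct, kronId, Matrix.of_apply,
        Fintype.sum_prod_type, ite_mul, zero_mul, Finset.sum_ite_eq, Finset.mem_univ,
        if_true] at this
      simp [block, Finset.sum_apply, ← this]
    rw [hv']
    exact Submodule.add_mem _ (Submodule.subset_span ⟨_, rfl⟩)
      (Submodule.sum_mem _ fun j _ => Submodule.smul_mem _ _ (Submodule.subset_span ⟨j, rfl⟩))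
  refine ⟨key, fun h => ?_⟩
  obtain ⟨z, hz⟩ := key
  have : z ∈ (Set.univ : Set (Fin K × Fin d → ℝ)) := Set.mem_univ z
  rw [← h] at this
  obtain ⟨W, hW⟩ := this
  exact hz W hW.symm
end
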